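/- Let u ∈ ℝ⁴ with η(u,u) = ε where ε = 1 or ε = −1, and let R = A·(η∘η) + B·(η∘(u♭⊗u♭)) with A, B ∈ ℝ, B ≠ 0. For w ∈ ℝ⁴ with η(u,w) = 0, let M_w ∈ so(1,3) be the matrix defined by M_w v = η(w,v)u − η(u,v)w, and let W_u = {M_w : w ∈ ℝ⁴, η(u,w) = 0}, a 3-dimensional subspace of so(1,3) complementary to the stabilizer g₀(R) = {M : Mu = 0}. If Γ : Fin 4 → W_u is any map satisfying the Bianchi constraint for R, then Γ_a = 0 for all a. (In the paper's language: for the conformally flat perfect fluid curvature types with g₀ ≅ so(3) or so(1,2), the Bianchi identities force all first-order invariants Γ̃^{ρ₁}_a to vanish.) -/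

import Mathlib

/- STATEMENT 5. Work in ℝ⁴ with the Minkowski form η = diag(1,1,1,−1).  Let
u be a unit vector (η(u,u) = ±1), R = A·(η∘η) + B·(η∘(u♭⊗u♭)) with B ≠ 0.
For w with η(u,w) = 0 let M_w be the matrix with M_w v = η(w,v)u − η(u,v)w.
If Γ : Fin 4 → so(1,3) takes values in W_u = {M_w : η(u,w) = 0} and satisfies
the Bianchi constraint for R, then Γ_a = 0 for all a. -/

open Matrix

noncomputable section

abbrev Mat4 := Matrix (Fin 4) (Fin 4) ℝ
abbrev Tensor4 := Fin 4 → Fin 4 → Fin 4 → Fin 4 → ℝ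

/-- The Minkowski form η = diag(1,1,1,−1). -/
def ηm : Mat4 := Matrix.diagonal ![1, 1, 1, -1]

/-- η as a (symmetric bilinear) array h_{ab}. -/
def ηf : Fin 4 → Fin 4 → ℝ := fun a b => ηm a b

/-- u♭, the covector η(u,·). -/
def flat (u : Fin 4 → ℝ) : Fin 4 → ℝ := ηm.mulVec u

/-- Membership in the Lorentz Lie algebra so(1,3): Mᵀη + ηM = 0. -/
def inSO13 (M : Mat4) : Prop := Mᵀ * ηm + ηm * M = 0

/-- Kulkarni–Nomizu product of two symmetric bilinear forms. -/
def kn (h k : Fin 4 → Fin 4 → ℝ) : Tensor4 := fun a b c d =>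
  h a c * k b d + h b d * k a c - h a d * k b c - h b c * k a d

/-- The action of so(1,3) on covariant 4-tensors:
    (M·R)_{abcd} = −Σ_e (Mᵉ_a R_{ebcd} + Mᵉ_b R_{aecd} + Mᵉ_c R_{abed} + Mᵉ_d R_{abce}). -/
def act (M : Mat4) (R : Tensor4) : Tensor4 := fun a b c d =>
  -(∑ e : Fin 4, (M e a * R e b c d + M e b * R a e c d
      + M e c * R a b e d + M e d * R a b c e))

/-- The stabilizer g₀(R) = {M ∈ so(1,3) : M·R = 0}. -/
def stab (R : Tensor4) : Set Mat4 := {M : Mat4 | inSO13 M ∧ act M R = 0}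

/-- R = A·(η∘η) + B·(η∘(u♭⊗u♭)). -/
def Rten (A B : ℝ) (u : Fin 4 → ℝ) : Tensor4 := fun a b c d =>
  A * kn ηf ηf a b c d + B * kn ηf (fun i j => flat u i * flat u j) a b c d

/-- η as a bilinear form on vectors. -/
def ηb (x y : Fin 4 → ℝ) : ℝ := x ⬝ᵥ ηm.mulVec y

/-- The matrix M_w determined by u and w:  M_w v = η(w,v)u − η(u,v)w. -/
def rotM (u w : Fin 4 → ℝ) : Mat4 :=
  Matrix.of fun a b => u a * flat w b - w a * flat u b

/-- The Bianchi constraint for Γ : Fin 4 → so(1,3) relative to R: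
(Γ_a·R)_{debc} + (Γ_b·R)_{deca} + (Γ_c·R)_{deab} = 0 for all indices. -/
def Bianchi (R : Tensor4) (Γ : Fin 4 → Mat4) : Prop :=
  ∀ a b c d e : Fin 4,
    act (Γ a) R d e b c + act (Γ b) R d e c a + act (Γ c) R d e a b = 0

/-- The Lie algebra action on covariant 2-tensors, up to sign. -/
def lieForm (M : Mat4) (h : Fin 4 → Fin 4 → ℝ) : Fin 4 → Fin 4 → ℝ := fun a b =>
  ∑ e : Fin 4, (M e a * h e b + M e b * h a e)

/-- The action of `M` is a derivation for the Kulkarni–Nomizu product. -/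
theorem act_kn (M : Mat4) (h k : Fin 4 → Fin 4 → ℝ) (a b c d : Fin 4) :
    act M (kn h k) a b c d = -(kn (lieForm M h) k a b c d + kn h (lieForm M k) a b c d) := by
  simp only [act, kn, lieForm, Fin.sum_univ_four]
  ring

theorem act_Rten (M : Mat4) (A B : ℝ) (u : Fin 4 → ℝ) (a b c d : Fin 4) :
    act M (Rten A B u) a b c d = A * act M (kn ηf ηf) a b c d
      + B * act M (kn ηf (fun i j => flat u i * flat u j)) a b c d := by
  simp only [act, Rten, Fin.sum_univ_four]
  ring

theorem sum_mul_ηf (v : Fin 4 → ℝ) (b : Fin 4) : ∑ e, v e * ηf e b = flat v b := by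
  simp [ηf, ηm, flat, Matrix.diagonal_apply, mulVec_diagonal, mul_comm]

theorem ηf_comm (a b : Fin 4) : ηf a b = ηf b a := by
  simp only [ηf, ηm, Matrix.diagonal_apply]
  grind

/-- `rotM u w` is skew with respect to `η`. -/
theorem lieForm_rotM_ηf (u w : Fin 4 → ℝ) : lieForm (rotM u w) ηf = 0 := by
  have key (a b : Fin 4) : ∑ e, rotM u w e a * ηf e b
      = flat u b * flat w a - flat w b * flat u a := by
    rw [← sum_mul_ηf u b, ← sum_mul_ηf w b]
    simp only [rotM, of_apply, Fin.sum_univ_four]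
    ring
  funext a b
  simp only [lieForm, Finset.sum_add_distrib, ηf_comm a, key, Pi.zero_apply]
  ring

theorem lieForm_rotM_flat (u w : Fin 4 → ℝ) (h : ηb u w = 0) (a b : Fin 4) :
    lieForm (rotM u w) (fun i j => flat u i * flat u j) a b
      = ηb u u * (flat w a * flat u b + flat u a * flat w b) := by
  have h' : ∑ e, w e * flat u e = 0 := by
    rw [← h]
    simp only [ηb, dotProduct, flat, ηm, mulVec_diagonal]
    exact Finset.sum_congr rfl fun _ _ => by ring
  change _ = (∑ i, u i * flat u i) * _
  simp only [lieForm, rotM, of_apply, Fin.sum_univ_four] at h' ⊢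
  linear_combination (-2 * flat u a * flat u b) * h'

theorem act_rotM_Rten (u w : Fin 4 → ℝ) (h : ηb u w = 0) (A B : ℝ) (a b c d : Fin 4) :
    act (rotM u w) (Rten A B u) a b c d = -(B * ηb u u) *
      kn ηf (fun i j => flat w i * flat u j + flat u i * flat w j) a b c d := by
  rw [act_Rten, act_kn, act_kn, lieForm_rotM_ηf]
  simp only [kn, lieForm_rotM_flat u w h, Pi.zero_apply]
  ring

/-- Contraction with the inverse of `η`, written out in coordinates. -/
theorem contract_ηf (f : Fin 4 → ℝ) (x : Fin 4) :
    ηf 0 x * f 0 + ηf 1 x * f 1 + ηf 2 x * f 2 - ηf 3 x * f 3 = f x := by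
  fin_cases x <;> simp [ηf, ηm]

/-- The Bianchi identity for `η ∘ S a` with `S a` trace-free: `S a e c` is invariant under
exchanging `a` and `c`. -/
theorem swap_of_kn_cyclic (S : Fin 4 → Fin 4 → Fin 4 → ℝ)
    (ht : ∀ a, S a 0 0 + S a 1 1 + S a 2 2 - S a 3 3 = 0)
    (hS : ∀ a b c d e, kn ηf (S a) d e b c + kn ηf (S b) d e c a + kn ηf (S c) d e a b = 0)
    (a c e : Fin 4) : S a e c = S c e a := by
  have d0 : ηf 0 0 = 1 := by simp [ηf, ηm]
  have d1 : ηf 1 1 = 1 := by simp [ηf, ηm]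
  have d2 : ηf 2 2 = 1 := by simp [ηf, ηm]
  have d3 : ηf 3 3 = -1 := by simp [ηf, ηm]
  let σ (c : Fin 4) : ℝ := S 0 0 c + S 1 1 c + S 2 2 c - S 3 3 c
  have contracted (a c e : Fin 4) :
      S a e c - S c e a + ηf e a * σ c - ηf e c * σ a = 0 := by
    have h (b : Fin 4) := hS a b c b e
    simp only [kn, ηf_comm e] at h ⊢
    have h0 := h 0
    have h1 := h 1
    have h2 := h 2
    have h3 := h 3
    simp only [d0, d1, d2, d3] at h0 h1 h2 h3
    simp only [σ]
    linear_combination h0 + h1 + h2 - h3 - ηf c e * ht a + ηf a e * ht c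
      + contract_ηf (S a e ·) c + contract_ηf (S a · c) e - contract_ηf (S · e a) c
      + contract_ηf (S · e c) a - contract_ηf (S c e ·) a - contract_ηf (S c · a) e
  have hσ (a : Fin 4) : σ a = 0 := by
    have h (x : Fin 4) := contracted a x x
    have h0 := h 0
    have h1 := h 1
    have h2 := h 2
    have h3 := h 3
    simp only [d0, d1, d2, d3] at h0 h1 h2 h3
    have hd : σ a = S 0 0 a + S 1 1 a + S 2 2 a - S 3 3 a := rfl
    linear_combination -(h0 + h1 + h2 - h3 - ht a - contract_ηf σ a - hd) / 4
  have := contracted a c e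
  rw [hσ, hσ] at this
  linarith

/-- A family of forms `φ a` vanishing on `u` with `φ a ⊙ θ` totally symmetric vanishes when
`θ u ≠ 0`. -/
theorem eq_zero_of_symm {ι : Type*} [Fintype ι] (u θ : ι → ℝ) (φ : ι → ι → ℝ)
    (hθ : ∑ i, u i * θ i ≠ 0) (hφ : ∀ a, ∑ i, u i * φ a i = 0)
    (h : ∀ a c e, φ a e * θ c + θ e * φ a c = φ c e * θ a + θ e * φ c a) (a c : ι) :
    φ a c = 0 := by
  have hsymm (a c : ι) : φ a c = φ c a := by
    have := Finset.sum_congr rfl fun e (_ : e ∈ Finset.univ) => congrArg (u e * ·) (h a c e)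
    simp only [mul_add, ← mul_assoc, Finset.sum_add_distrib, ← Finset.sum_mul, hφ] at this
    simpa [hθ] using this
  have key : (∑ i, u i * θ i) * φ a c = (∑ i, u i * φ c i) * θ a := by
    simp only [Finset.sum_mul]
    refine Finset.sum_congr rfl fun i _ => ?_
    linear_combination u i * h a i c + u i * θ a * hsymm i c + u i * θ c * hsymm i a
  rw [hφ, zero_mul] at key
  exact (mul_eq_zero.mp key).resolve_left hθ

/-- For the conformally flat perfect fluid curvature types (u unit timelike or
unit spacelike, so g₀ ≅ so(3) or so(1,2)): if Γ : Fin 4 → W_u satisfies the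
Bianchi constraint for R = A·(η∘η) + B·(η∘(u♭⊗u♭)), B ≠ 0, then Γ vanishes. -/
theorem bianchi_perfect_fluid_rigidity (u : Fin 4 → ℝ) (ε : ℝ)
    (hε : ε = 1 ∨ ε = -1) (hu : ηb u u = ε) (A B : ℝ) (hB : B ≠ 0)
    (Γ : Fin 4 → Mat4)
    (hW : ∀ a : Fin 4, ∃ w : Fin 4 → ℝ, ηb u w = 0 ∧ Γ a = rotM u w)
    (hbianchi : Bianchi (Rten A B u) Γ) :
    ∀ a : Fin 4, Γ a = 0 := by
  choose w hw hΓ using hW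
  have hε0 : ηb u u ≠ 0 := by
    rw [hu]
    rcases hε with rfl | rfl <;> norm_num
  have htr (a : Fin 4) := hw a
  simp only [ηb, dotProduct, ηm, mulVec_diagonal, Fin.sum_univ_four] at htr
  have hsymm := swap_of_kn_cyclic
    (fun a i j => flat (w a) i * flat u j + flat u i * flat (w a) j)
    (fun a => by
      have := htr a
      simp [flat, ηm, mulVec_diagonal] at this ⊢
      linear_combination 2 * this)
    (fun a b c d e => by
      have := hbianchi a b c d e
      simp only [hΓ, act_rotM_Rten u _ (hw _)] at this
      rw [← mul_add, ← mul_add] at this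
      exact (mul_eq_zero.mp this).resolve_left (neg_ne_zero.mpr (mul_ne_zero hB hε0)))
  have hflat := eq_zero_of_symm u (flat u) (fun a => flat (w a)) hε0 hw
    fun a c e => hsymm a c e
  intro a
  have hw0 (b : Fin 4) : w a b = 0 := by
    have := hflat a b
    simp only [flat, ηm, mulVec_diagonal] at this
    fin_cases b <;> simpa using this
  ext i j
  simp [hΓ, rotM, hflat, hw0]

end
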